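/- Let (D_n)_{n∈ℕ} be open subsets of ℂ, each containing 0, and for j ∈ ℕ let V_j denote the connected component containing 0 of the interior of ⋂_{k ≥ j} D_k. Let (K_n)_{n∈ℕ} be nonempty compact subsets of ℂ with K_n ∩ D_n = ∅ for every n, and suppose K_n converges to a nonempty compact set K in the Hausdorff metric. Then K ∩ (⋃_{j∈ℕ} V_j) = ∅. -/

import Mathlib

/-- Hausdorff limits of compact sets disjoint from a sequence of domains are disjoint
from the Carathéodory kernel (viewed from `0`) of the domains. -/
theorem hausdorff_limit_disjoint_kernel (D : ℕ → Set ℂ)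
    (hD : ∀ n, IsOpen (D n)) (h0 : ∀ n, (0 : ℂ) ∈ D n)
    (K : ℕ → Set ℂ) (hKc : ∀ n, IsCompact (K n)) (hKne : ∀ n, (K n).Nonempty)
    (hdisj : ∀ n, K n ∩ D n = ∅)
    (Klim : Set ℂ) (hKlimc : IsCompact Klim) (hKlimne : Klim.Nonempty)
    (hconv : Filter.Tendsto (fun n => Metric.hausdorffDist (K n) Klim)
      Filter.atTop (nhds 0)) :
    Klim ∩ (⋃ j : ℕ, connectedComponentIn (interior (⋂ k ∈ Set.Ici j, D k)) 0) = ∅ := by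
  refine Set.eq_empty_iff_forall_notMem.2 fun z hz => ?_
  obtain ⟨hzK, hzV⟩ := hz
  obtain ⟨j, hj⟩ := Set.mem_iUnion.1 hzV
  obtain ⟨r, hr, hball⟩ := Metric.mem_nhds_iff.1
    (mem_interior_iff_mem_nhds.1 (connectedComponentIn_subset _ _ hj))
  obtain ⟨n, hn, hjn⟩ :=
    ((hconv.eventually (gt_mem_nhds hr)).and (Filter.eventually_ge_atTop j)).exists
  obtain ⟨x, hxK, hxr⟩ := Metric.exists_dist_lt_of_hausdorffDist_lt' hzK hn
    (Metric.hausdorffEDist_ne_top_of_nonempty_of_bounded (hKne n) hKlimne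
      (hKc n).isBounded hKlimc.isBounded)
  have hxD : x ∈ D n := Set.mem_iInter₂.1 (hball hxr) n hjn
  exact Set.eq_empty_iff_forall_notMem.1 (hdisj n) x ⟨hxK, hxD⟩
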